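/- arXiv:1707.06860 — 8 statements merged into one kernel-verified Lean document; each statement's English description precedes it below -/
import Mathlib

section
/- The 5×5 matrix multiplication map over the rational numbers has bilinear complexity (rank) at most 99: there exist 99 linear forms φ₁,…,φ₉₉ on the space of 5×5 rational matrices, 99 linear forms ψ₁,…,ψ₉₉ on the space of 5×5 rational matrices, and 99 fixed 5×5 rational matrices W₁,…,W₉₉, such that for all 5×5 rational matrices A and B one has A·B = Σ_{k=1}^{99} φ_k(A)·ψ_k(B)·W_k. -/
/-- The `i`-th digit of `n` in base three, shifted to take the values `-1`, `0`, `1`. -/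
def signDigit (n i : ℕ) : ℤ := ((n / 3 ^ i % 3 : ℕ) : ℤ) - 1

theorem abs_signDigit_le_one (n i : ℕ) : |signDigit n i| ≤ 1 := by
  unfold signDigit
  rw [abs_le]
  omega

/-- The coefficients of the trilinear form `tr (X * Y * Z)` on `5 × 5` matrices, where the entry
`(i, j)` of a matrix has index `5 * i + j`. -/
def traceCoeff (u v w : ℕ) : ℤ :=
  if u % 5 = v / 5 ∧ v % 5 = w / 5 ∧ w % 5 = u / 5 then 1 else 0

/-- Codes (see `signDigit`) of matrices `M` contributing `M ⊗ M ⊗ M`. -/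
def cubeCodes : List ℕ :=
  [423644304722, 706073841931, 424032256651]

/-- Codes (see `signDigit`) of triples of matrices contributing the sum of the three cyclic
rotations of `L ⊗ M ⊗ N`. -/
def orbitCodes : List (ℕ × ℕ × ℕ) :=
  [(423644305450, 266736360406, 720408399295),
   (427131148171, 423644304682, 392105407126),
   (423644304561, 141214768243, 430617872794),
   (423815960164, 134236309268, 454637943841),
   (141214768240, 434104657195, 423644284469),
   (329113711966, 424806566188, 465485894680),
   (423258478555, 424160865373, 423644836162),
   (423256884232, 423515696728, 266736360406),
   (423644307405, 424287348331, 423687351442),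
   (517946259748, 420143171330, 392263245115),
   (420157520320, 423644305691, 266736349426),
   (420157461309, 392650665592, 423486998185),
   (423644304964, 423644304805, 430617873526),
   (453992243035, 420157343173, 423644304516),
   (517789071310, 133050240240, 392263245112),
   (427145438029, 423644304733, 517946266336),
   (549168543157, 455197549027, 713052311154),
   (713052290902, 329113705405, 423687351442),
   (559671943081, 455025362143, 424673174497),
   (453992243026, 423644127574, 423644295449),
   (455183200120, 427131148088, 549168543154),
   (427131148160, 518174904064, 423615606907),
   (393296368603, 716534371552, 549168543886),
   (423644304718, 367854813409, 423644304804),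
   (455025365059, 328470668356, 716577241126),
   (518817947674, 420114473599, 423644304489),
   (423644303995, 423644315701, 395750029513),
   (392263245103, 423801493159, 427145438067),
   (559629073507, 392650667788, 424677957466),
   (423644293741, 455025364330, 423815783743)]

/-- Codes of the rank one terms of a decomposition of the trace form. -/
def termCodes : List (ℕ × ℕ × ℕ) :=
  cubeCodes.map (fun m => (m, m, m)) ++
    orbitCodes.flatMap (fun t => [t, (t.2.1, t.2.2, t.1), (t.2.2, t.1, t.2.1)])

/-- The `k`-th term of the decomposition; `423644304721` is the code of the zero matrix. -/
def termCode (k : Fin 99) : ℕ × ℕ × ℕ :=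
  termCodes.getD k (423644304721, 423644304721, 423644304721)

/-- The value at `x` of the polynomial with coefficients `d 0, …, d (n - 1)`. -/
def packSum (x : ℤ) (d : ℕ → ℤ) : ℕ → ℤ
  | 0 => 0
  | n + 1 => packSum x d n + d n * x ^ n

theorem packSum_eq_sum (x : ℤ) (d : ℕ → ℤ) (n : ℕ) :
    packSum x d n = ∑ i ∈ Finset.range n, d i * x ^ i := by
  induction n with
  | zero => rfl
  | succ n ih => rw [Finset.sum_range_succ, ← ih, packSum]

theorem packSum_sub (x : ℤ) (d e : ℕ → ℤ) (n : ℕ) :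
    packSum x (fun i => d i - e i) n = packSum x d n - packSum x e n := by
  simp only [packSum_eq_sum, sub_mul, Finset.sum_sub_distrib]

theorem packSum_sum {ι : Type*} [Fintype ι] (x : ℤ) (d : ι → ℕ → ℤ) (n : ℕ) :
    packSum x (fun i => ∑ k, d k i) n = ∑ k, packSum x (d k) n := by
  simp only [packSum_eq_sum, Finset.sum_mul]
  exact Finset.sum_comm

theorem packSum_mul_left (x s : ℤ) (d : ℕ → ℤ) (n : ℕ) :
    packSum x (fun i => s * d i) n = s * packSum x d n := by
  simp only [packSum_eq_sum, Finset.mul_sum, mul_assoc]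

theorem packSum_mul_right (x s : ℤ) (d : ℕ → ℤ) (n : ℕ) :
    packSum x (fun i => d i * s) n = packSum x d n * s := by
  simp only [mul_comm _ s, packSum_mul_left]

theorem eq_zero_of_packSum_eq_zero {x : ℤ} {n : ℕ} {d : ℕ → ℤ} (hd : ∀ i < n, |d i| < x)
    (h : packSum x d n = 0) : ∀ i < n, d i = 0 := by
  rw [packSum_eq_sum] at h
  induction n generalizing d with
  | zero => simp
  | succ n ih =>
    rw [Finset.sum_range_succ'] at h
    have hmul : ∑ i ∈ Finset.range n, d (i + 1) * x ^ (i + 1) =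
        x * ∑ i ∈ Finset.range n, d (i + 1) * x ^ i := by
      rw [Finset.mul_sum]
      exact Finset.sum_congr rfl fun i _ => by ring
    rw [hmul, pow_zero, mul_one] at h
    have h0 : d 0 = 0 :=
      Int.eq_zero_of_abs_lt_dvd (m := x) ⟨-∑ i ∈ Finset.range n, d (i + 1) * x ^ i, by linarith⟩
        (hd 0 n.succ_pos)
    have hx : x ≠ 0 := ((abs_nonneg _).trans_lt (hd 0 n.succ_pos)).ne'
    rw [h0, add_zero] at h
    have ht := ih (d := fun i => d (i + 1)) (fun i hi => hd (i + 1) (by omega))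
      ((mul_eq_zero.mp h).resolve_left hx)
    rintro (_ | i) hi
    · exact h0
    · exact ht i (by omega)

theorem packSum_mul (x : ℤ) (d : ℕ → ℤ) (m n : ℕ) :
    packSum x d (m * n) = packSum (x ^ n) (fun i => packSum x (fun j => d (i * n + j)) n) m := by
  induction m with
  | zero => simp [packSum]
  | succ m ih =>
    rw [packSum, ← ih, Nat.succ_mul]
    simp only [packSum_eq_sum]
    rw [Finset.sum_range_add, Finset.sum_mul]
    congr 1
    exact Finset.sum_congr rfl fun j _ => by rw [pow_add, ← pow_mul, mul_comm n m]; ring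

/-- The value of a trilinear array at the point `(x ^ 625, x ^ 25, x)`. -/
def packTensor (x : ℤ) (d : ℕ → ℕ → ℕ → ℤ) : ℤ :=
  packSum (x ^ 625) (fun u => packSum (x ^ 25) (fun v => packSum x (d u v) 25) 25) 25

theorem eq_zero_of_packTensor_eq_zero {x : ℤ} {d : ℕ → ℕ → ℕ → ℤ} (hd : ∀ u v w, |d u v w| < x)
    (h : packTensor x d = 0) {u v w : ℕ} (hu : u < 25) (hv : v < 25) (hw : w < 25) :
    d u v w = 0 := by
  let e : ℕ → ℤ := fun m => d (m / 625) (m / 25 % 25) (m % 25)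
  have he : ∀ u, ∀ v < 25, ∀ w < 25, e (u * 625 + (v * 25 + w)) = d u v w := by
    intro u v hv w hw
    have h1 : (u * 625 + (v * 25 + w)) / 625 = u := by omega
    have h2 : (u * 625 + (v * 25 + w)) / 25 % 25 = v := by omega
    have h3 : (u * 625 + (v * 25 + w)) % 25 = w := by omega
    simp only [e, h1, h2, h3]
  have hinner (u : ℕ) : packSum x (fun j => e (u * 625 + j)) (25 * 25) =
      packSum (x ^ 25) (fun v => packSum x (d u v) 25) 25 := by
    rw [packSum_mul, packSum_eq_sum, packSum_eq_sum]
    refine Finset.sum_congr rfl fun v hv => ?_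
    rw [packSum_eq_sum x (d u v), packSum_eq_sum, Finset.sum_congr rfl fun w hw => by
      rw [he u v (Finset.mem_range.mp hv) w (Finset.mem_range.mp hw)]]
  norm_num only at hinner
  have hpack : packSum x e (25 * 625) = 0 := by
    simp only [packSum_mul, hinner]
    exact h
  rw [← he u v hv w hw]
  exact eq_zero_of_packSum_eq_zero (fun i _ => hd _ _ _) hpack _ (by omega)

theorem packTensor_sum_mul_sub {ι : Type*} [Fintype ι] (x : ℤ) (a b c : ι → ℕ → ℤ)
    (t : ℕ → ℕ → ℕ → ℤ) :
    packTensor x (fun u v w => ∑ k, a k u * b k v * c k w - t u v w) =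
      ∑ k, packSum (x ^ 625) (a k) 25 * packSum (x ^ 25) (b k) 25 * packSum x (c k) 25 -
        packTensor x t := by
  simp only [packTensor, packSum_sub, packSum_sum, packSum_mul_left, packSum_mul_right]

/-- The decomposition evaluates correctly at `(256 ^ 625, 256 ^ 25, 256)`. By
`eq_zero_of_packTensor_eq_zero` this single equality of integers checks all coefficients. -/
theorem packSum_termCode_eq_packTensor_traceCoeff :
    ∑ k : Fin 99, packSum ((256 : ℤ) ^ 625) (signDigit (termCode k).1) 25 *
      packSum (256 ^ 25) (signDigit (termCode k).2.1) 25 *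
        packSum 256 (signDigit (termCode k).2.2) 25 = packTensor 256 traceCoeff := by
  decide +kernel

theorem sum_signDigit_termCode (u v w : ℕ) (hu : u < 25) (hv : v < 25) (hw : w < 25) :
    ∑ k, signDigit (termCode k).1 u * signDigit (termCode k).2.1 v *
      signDigit (termCode k).2.2 w = traceCoeff u v w := by
  refine sub_eq_zero.mp (eq_zero_of_packTensor_eq_zero (x := 256)
    (d := fun u v w => ∑ k, signDigit (termCode k).1 u * signDigit (termCode k).2.1 v *
      signDigit (termCode k).2.2 w - traceCoeff u v w) (fun u v w => ?_) ?_ hu hv hw)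
  · have hsum : |∑ k, signDigit (termCode k).1 u * signDigit (termCode k).2.1 v *
        signDigit (termCode k).2.2 w| ≤ ∑ _k : Fin 99, (1 : ℤ) := by
      refine (Finset.abs_sum_le_sum_abs _ _).trans (Finset.sum_le_sum fun k _ => ?_)
      rw [abs_mul, abs_mul]
      exact mul_le_one₀ (mul_le_one₀ (abs_signDigit_le_one _ _) (abs_nonneg _)
        (abs_signDigit_le_one _ _)) (abs_nonneg _) (abs_signDigit_le_one _ _)
    have ht : |traceCoeff u v w| ≤ 1 := by
      unfold traceCoeff
      split_ifs <;> simp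
    refine (abs_sub _ _).trans_lt ?_
    simp only [Finset.sum_const, Finset.card_univ, Fintype.card_fin] at hsum
    norm_num at hsum
    linarith
  · rw [packTensor_sum_mul_sub, packSum_termCode_eq_packTensor_traceCoeff, sub_self]

/-- A decomposition of the trace form into rank one terms gives a bilinear algorithm. -/
theorem exists_bilinear_algorithm {r : ℕ} (a b c : Fin r → ℕ → ℤ)
    (h : ∀ u v w, u < 25 → v < 25 → w < 25 → ∑ k, a k u * b k v * c k w = traceCoeff u v w) :
    ∃ (φ ψ : Fin r → (Matrix (Fin 5) (Fin 5) ℚ →ₗ[ℚ] ℚ))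
      (W : Fin r → Matrix (Fin 5) (Fin 5) ℚ),
      ∀ A B : Matrix (Fin 5) (Fin 5) ℚ, A * B = ∑ k : Fin r, (φ k A * ψ k B) • W k := by
  let form (d : ℕ → ℤ) : Matrix (Fin 5) (Fin 5) ℚ →ₗ[ℚ] ℚ :=
    ∑ i : Fin 5, ∑ j : Fin 5, (d (5 * i + j) : ℚ) • Matrix.entryLinearMap ℚ ℚ i j
  have form_apply (d : ℕ → ℤ) (A : Matrix (Fin 5) (Fin 5) ℚ) :
      form d A = ∑ x : Fin 5 × Fin 5, (d (5 * x.1 + x.2) : ℚ) * A x.1 x.2 := by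
    simp [form, Fintype.sum_prod_type]
  refine ⟨fun k => form (a k), fun k => form (b k),
    fun k => Matrix.of fun p q => (c k (5 * q + p) : ℚ), fun A B => ?_⟩
  ext p q
  have hcoeff (x y : Fin 5 × Fin 5) :
      ∑ k, (a k (5 * x.1 + x.2) : ℚ) * b k (5 * y.1 + y.2) * c k (5 * q + p) =
        if x.1 = p ∧ x.2 = y.1 ∧ y.2 = q then 1 else 0 := by
    have := h (5 * x.1 + x.2) (5 * y.1 + y.2) (5 * q + p) (by omega) (by omega) (by omega)
    rw [traceCoeff] at this
    have hiff : ((5 * x.1 + x.2 : ℕ) % 5 = (5 * y.1 + y.2 : ℕ) / 5 ∧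
        (5 * y.1 + y.2 : ℕ) % 5 = (5 * q + p : ℕ) / 5 ∧
        (5 * q + p : ℕ) % 5 = (5 * x.1 + x.2 : ℕ) / 5) ↔
        (x.1 = p ∧ x.2 = y.1 ∧ y.2 = q) := by
      have hdiv (i j : Fin 5) : (5 * i + j : ℕ) / 5 = i := by omega
      have hmod (i j : Fin 5) : (5 * i + j : ℕ) % 5 = j := by omega
      simp only [hdiv, hmod, Fin.ext_iff]
      omega
    simp only [hiff] at this
    exact_mod_cast this
  calc (A * B) p q
      = ∑ x : Fin 5 × Fin 5, ∑ y : Fin 5 × Fin 5,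
          (if x.1 = p ∧ x.2 = y.1 ∧ y.2 = q then 1 else 0) * (A x.1 x.2 * B y.1 y.2) := by
        simp [Matrix.mul_apply, Fintype.sum_prod_type, ite_and]
    _ = ∑ x : Fin 5 × Fin 5, ∑ y : Fin 5 × Fin 5, ∑ k,
          (a k (5 * x.1 + x.2) * A x.1 x.2) * (b k (5 * y.1 + y.2) * B y.1 y.2) *
            c k (5 * q + p) := by
        refine Finset.sum_congr rfl fun x _ => Finset.sum_congr rfl fun y _ => ?_
        rw [← hcoeff, Finset.sum_mul]
        exact Finset.sum_congr rfl fun k _ => by ring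
    _ = ∑ k, ∑ x : Fin 5 × Fin 5, ∑ y : Fin 5 × Fin 5,
          (a k (5 * x.1 + x.2) * A x.1 x.2) * (b k (5 * y.1 + y.2) * B y.1 y.2) *
            c k (5 * q + p) := by
        rw [Finset.sum_comm (s := (Finset.univ : Finset (Fin r)))]
        exact Finset.sum_congr rfl fun x _ => Finset.sum_comm
    _ = (∑ k, (form (a k) A * form (b k) B) •
          Matrix.of fun p q : Fin 5 => (c k (5 * q + p) : ℚ)) p q := by
        simp only [Matrix.sum_apply, Matrix.smul_apply, Matrix.of_apply, smul_eq_mul, form_apply]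
        refine Finset.sum_congr rfl fun k _ => ?_
        rw [Finset.sum_mul_sum]
        simp only [Finset.sum_mul]

/-- The 5×5 matrix multiplication map over ℚ has bilinear complexity (rank) at most 99. -/
theorem rank_matmul_5x5_le_99 :
    ∃ (φ ψ : Fin 99 → (Matrix (Fin 5) (Fin 5) ℚ →ₗ[ℚ] ℚ))
      (W : Fin 99 → Matrix (Fin 5) (Fin 5) ℚ),
      ∀ A B : Matrix (Fin 5) (Fin 5) ℚ,
        A * B = ∑ k : Fin 99, (φ k A * ψ k B) • W k := by
  exact exists_bilinear_algorithm (fun k => signDigit (termCode k).1)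
    (fun k => signDigit (termCode k).2.1) (fun k => signDigit (termCode k).2.2)
    sum_signDigit_termCode
end

section
/- For every field K containing a nonzero element ℓ, the 5×5 matrix multiplication map over K admits a bilinear algorithm using 99 coefficient multiplications: there exist linear forms φ₁,…,φ₉₉ and ψ₁,…,ψ₉₉ on 5×5 matrices over K and fixed 5×5 matrices W₁,…,W₉₉ over K (whose coefficients are polynomials in ℓ and ℓ⁻¹ with integer coefficients) such that A·B = Σ_{k=1}^{99} φ_k(A)·ψ_k(B)·W_k for all 5×5 matrices A, B over K. -/
namespace MatMulFive

open Matrix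

/-- Integer `5 × 5` matrices: the coefficient matrices of the bilinear algorithm. -/
abbrev Coeff := Matrix (Fin 5) (Fin 5) ℤ

/-- The matrix units. -/
def E (i j : Fin 5) : Coeff := Matrix.single i j 1

/-- Representatives of the orbits of length three under cyclic rotation of the tensor factors. -/
def orbits : List (Coeff × Coeff × Coeff) :=
  [(E 2 0 + E 3 1,
    E 0 0 + E 1 1,
    E 0 2 + E 1 3),
   (E 2 4 - E 3 4 - E 4 4,
    E 0 2 + E 0 3 - E 1 2 - E 1 3 - E 2 2 - E 2 3 + E 3 2 + E 3 3 - E 4 2 - E 4 3,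
    E 2 4 - E 0 4),
   (E 1 1,
    E 0 0 - E 0 2 - E 1 0 + E 1 2 - E 1 4 + E 2 0 - E 2 2 + E 2 4 - E 3 0 + E 3 2
      - E 3 4 + E 4 2 - E 4 4,
    E 2 0 + E 2 1 + E 2 2 + E 2 3),
   (E 0 4 - E 1 4 - E 2 4 + E 3 4,
    E 4 0 + E 4 2,
    -E 2 1 - E 4 1),
   (E 0 3 - E 0 4 - E 2 3 + E 2 4 - E 4 3,
    E 0 4 - E 2 4 + E 3 4,
    E 4 0),
   (E 2 1 + E 2 3 - E 3 1 - E 3 3,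
    E 1 2 + E 1 3,
    E 0 2 + E 2 2),
   (E 2 4 - E 3 4 - E 4 3 - E 4 4,
    E 1 2 + E 1 3 - E 3 2 - E 3 3 + E 4 0 + E 4 2,
    E 2 0 - E 0 4 + E 2 2 + E 2 4),
   (E 2 0 + E 2 1 + E 2 2 + E 2 3 + E 4 1,
    E 1 1 - E 3 1 + E 3 3 - E 3 4,
    E 1 4 - E 2 4 + E 3 4 - E 4 2 + E 4 4),
   (E 1 0 + E 1 1 - E 1 2 - E 1 3,
    E 0 2,
    E 1 1 - E 0 1 + E 2 1 - E 3 1),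
   (E 0 2 - E 1 2 + E 2 4 - E 3 4 + E 4 2 - E 4 4,
    E 2 2 + E 2 3,
    E 1 1 - E 3 1),
   (E 4 0,
    E 0 0 + E 0 2 + E 0 4 - E 1 0 - E 2 0 - E 2 2 - E 2 4,
    E 0 4),
   (E 2 2 + E 3 3,
    E 2 0 + E 3 1,
    E 0 2 + E 1 3),
   (E 4 3,
    E 3 3 - E 3 4,
    E 0 4 + E 1 4 - E 2 4 + E 3 4),
   (E 2 4 - E 3 4 + E 4 2 - E 4 4,
    E 2 0 + E 2 1 + E 4 1,
    E 0 4 + E 1 1 - E 1 3 - E 2 4 - E 3 1 + E 3 3),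
   (E 0 0 + E 0 1,
    E 1 1 - E 1 3,
    E 2 0 - E 2 2 + E 2 4 - E 3 0 + E 3 2 - E 3 4 + E 4 2 - E 4 4),
   (E 0 0 - E 1 0 - E 2 4 + E 3 4 + E 4 0 + E 4 4,
    E 0 2 + E 0 3,
    E 3 3 - E 3 1),
   (E 0 0 - E 1 0 + E 2 0 - E 3 0,
    E 0 0 + E 0 1 + E 0 2 + E 0 3 + E 2 0 + E 2 1 + E 2 2 + E 2 3,
    -E 3 3),
   (E 2 0 + E 2 2 + E 2 4,
    E 4 3 + E 4 4,
    E 4 0 + E 4 2),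
   (E 0 3 - E 1 3 - E 2 3 + E 3 3,
    E 3 0 + E 3 1 - E 3 2 - E 3 3,
    -E 2 0),
   (E 0 4,
    E 4 0 + E 4 1 + E 4 3,
    E 1 0),
   (E 0 4,
    E 4 3,
    E 3 0 - E 1 0 - E 1 2 - E 1 3 + E 3 2 + E 3 4 - E 4 0 - E 4 2),
   (E 0 2 - E 2 0,
    E 0 1 - E 1 1 + E 2 3 - E 3 3,
    E 3 0 - E 1 2 - E 1 3 + E 3 1),
   (E 0 1 - E 1 1,
    E 1 0 + E 1 1 - E 3 0 - E 3 1,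
    E 0 0 + E 0 2),
   (E 0 0 + E 0 1 + E 2 0 + E 2 1,
    E 1 3 - E 3 3,
    E 2 4 - E 2 2 + E 3 2 - E 3 4 + E 4 2 - E 4 4),
   (E 0 0 + E 0 1 + E 2 0 + E 2 1 + E 2 2 + E 2 3,
    E 1 1 - E 3 3,
    E 1 0 - E 0 0 - E 2 0 + E 2 2 - E 2 4 + E 3 0 - E 3 2 + E 3 4 - E 4 2 + E 4 4),
   (E 2 4,
    E 4 1 + E 4 3,
    E 1 2 + E 1 3),
   (E 2 4 - E 3 4 - E 4 0 - E 4 4,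
    E 0 2 + E 0 3 - E 2 0 - E 2 1 - E 2 2 - E 2 3 - E 4 1 - E 4 3,
    E 0 4 - E 2 4 - E 3 1 + E 3 3),
   (E 2 0 + E 2 2,
    E 2 3 + E 2 4 - E 3 3 - E 3 4 - E 4 3 - E 4 4,
    E 3 2 - E 1 2 - E 1 3 + E 3 3),
   (E 3 0 + E 3 1,
    E 0 0 + E 2 0,
    E 0 1 + E 0 3 - E 1 1 - E 1 3),
   (E 4 2 - E 4 4,
    E 4 1,
    E 1 3 - E 1 4),
   (E 4 0,
    E 0 1 - E 2 1 - E 4 1,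
    E 1 4),
   (E 3 1 - E 3 3 + E 3 4,
    E 1 4 - E 2 4 + E 3 4 + E 4 0 + E 4 4,
    E 2 0 + E 2 1 + E 2 2 + E 2 3 + E 4 1 + E 4 3)]

/-- The rank-one terms that are invariant under cyclic rotation of the tensor factors. -/
def fixedTerms : List Coeff :=
  [E 0 0 + E 1 1, E 2 2 + E 3 3, E 4 4]

/-- A decomposition of the trace form `tr (A * B * C)` into 99 products of linear forms, invariant
under cyclic rotation of the three factors. -/
def traceDecomposition : List (Coeff × Coeff × Coeff) :=
  orbits.flatMap (fun t => [t, (t.2.1, t.2.2, t.1), (t.2.2, t.1, t.2.1)]) ++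
    fixedTerms.map fun X => (X, X, X)

theorem length_traceDecomposition : traceDecomposition.length = 99 := rfl

section Pairing

variable {R : Type*} [CommRing R]

/-- The linear form `A ↦ ∑ i j, X i j * A i j` with integer coefficients `X`. -/
def pairing (X : Coeff) : Matrix (Fin 5) (Fin 5) R →ₗ[R] R :=
  ∑ i, ∑ j, (X i j : R) • Matrix.entryLinearMap R R i j

theorem pairing_apply (X : Coeff) (A : Matrix (Fin 5) (Fin 5) R) :
    pairing X A = ∑ i, ∑ j, (X i j : R) * A i j := by
  simp [pairing]

theorem pairing_add (X Y : Coeff) (A : Matrix (Fin 5) (Fin 5) R) :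
    pairing (X + Y) A = pairing X A + pairing Y A := by
  simp [pairing_apply, add_mul, Finset.sum_add_distrib]

theorem pairing_neg (X : Coeff) (A : Matrix (Fin 5) (Fin 5) R) :
    pairing (-X) A = -pairing X A := by
  simp [pairing_apply]

theorem pairing_sub (X Y : Coeff) (A : Matrix (Fin 5) (Fin 5) R) :
    pairing (X - Y) A = pairing X A - pairing Y A := by
  rw [sub_eq_add_neg, pairing_add, pairing_neg, sub_eq_add_neg]

theorem pairing_E (i j : Fin 5) (A : Matrix (Fin 5) (Fin 5) R) :
    pairing (E i j) A = A i j := by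
  simp [pairing_apply, E, Matrix.single_apply, ite_and]

theorem E_apply (i j k l : Fin 5) : E i j k l = if i = k ∧ j = l then 1 else 0 :=
  Matrix.single_apply ..

set_option maxHeartbeats 8000000 in
theorem mul_eq_sum_traceDecomposition (A B : Matrix (Fin 5) (Fin 5) R) :
    A * B = (traceDecomposition.map fun t =>
      (pairing t.1 A * pairing t.2.1 B) • t.2.2ᵀ.map (Int.cast : ℤ → R)).sum := by
  simp only [traceDecomposition, orbits, fixedTerms, List.flatMap_cons, List.flatMap_nil,
    List.map_cons, List.map_nil, List.cons_append, List.nil_append, List.append_nil,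
    List.sum_cons, List.sum_nil, pairing_add, pairing_sub, pairing_neg, pairing_E]
  ext i j
  fin_cases i <;> fin_cases j <;>
  · simp [Matrix.mul_apply, Fin.sum_univ_five, E_apply]
    ring

end Pairing

/-- A list of products of linear forms that computes matrix multiplication is a bilinear
algorithm with as many multiplications as the length of the list. -/
theorem exists_algorithm_of_list {K : Type*} [Field K] (S : Subring K) {n : ℕ}
    (L : List (Coeff × Coeff × Coeff)) (hL : L.length = n)
    (h : ∀ A B : Matrix (Fin 5) (Fin 5) K, A * B = (L.map fun t =>
      (pairing t.1 A * pairing t.2.1 B) • t.2.2ᵀ.map (Int.cast : ℤ → K)).sum) :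
    ∃ (φ ψ : Fin n → (Matrix (Fin 5) (Fin 5) K →ₗ[K] K))
      (W : Fin n → Matrix (Fin 5) (Fin 5) K),
      (∀ k (i j : Fin 5), W k i j ∈ S) ∧
      ∀ A B : Matrix (Fin 5) (Fin 5) K, A * B = ∑ k, (φ k A * ψ k B) • W k := by
  subst hL
  refine ⟨fun k => pairing L[k].1, fun k => pairing L[k].2.1,
    fun k => L[k].2.2ᵀ.map (Int.cast : ℤ → K), fun k i j => intCast_mem S _, fun A B => ?_⟩
  rw [h A B, ← Fin.sum_univ_fun_getElem]
  rfl

end MatMulFive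

/-- For every field `K` containing a nonzero element `ℓ`, the 5×5 matrix multiplication
map over `K` admits a bilinear algorithm using 99 coefficient multiplications, where the
coefficients of the fixed matrices `W k` are polynomials in `ℓ` and `ℓ⁻¹` with integer
coefficients (i.e. lie in the subring generated by `ℓ` and `ℓ⁻¹`). -/
theorem matmul_5x5_algorithm_with_99_mults (K : Type*) [Field K] (ℓ : K) (hℓ : ℓ ≠ 0) :
    ∃ (φ ψ : Fin 99 → (Matrix (Fin 5) (Fin 5) K →ₗ[K] K))
      (W : Fin 99 → Matrix (Fin 5) (Fin 5) K),
      (∀ k (i j : Fin 5), W k i j ∈ Subring.closure ({ℓ, ℓ⁻¹} : Set K)) ∧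
      ∀ A B : Matrix (Fin 5) (Fin 5) K,
        A * B = ∑ k : Fin 99, (φ k A * ψ k B) • W k := by
  exact MatMulFive.exists_algorithm_of_list _ _ MatMulFive.length_traceDecomposition
    MatMulFive.mul_eq_sum_traceDecomposition
end

section
/- The 5×5 matrix multiplication map over the rational numbers has bilinear complexity at most 101: there exist 101 linear forms φ₁,…,φ₁₀₁ on 5×5 rational matrices, 101 linear forms ψ₁,…,ψ₁₀₁ on 5×5 rational matrices, and 101 fixed 5×5 rational matrices W₁,…,W₁₀₁ such that A·B = Σ_{k=1}^{101} φ_k(A)·ψ_k(B)·W_k for all 5×5 rational matrices A and B. -/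
section BilinearRank

variable (R : Type*) [CommRing R]
  {V V' W W' U U' : Type*} [AddCommGroup V] [Module R V] [AddCommGroup V'] [Module R V']
  [AddCommGroup W] [Module R W] [AddCommGroup W'] [Module R W']
  [AddCommGroup U] [Module R U] [AddCommGroup U'] [Module R U']

/-- The map `f` is computed by a bilinear algorithm with `r` multiplications. -/
def BilinearRankLE (f : V → W → U) (r : ℕ) : Prop :=
  ∃ (φ : Fin r → V →ₗ[R] R) (ψ : Fin r → W →ₗ[R] R) (w : Fin r → U),
    ∀ a b, f a b = ∑ k, (φ k a * ψ k b) • w k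

variable {R}

theorem BilinearRankLE.add {f g : V → W → U} {r s : ℕ}
    (hf : BilinearRankLE R f r) (hg : BilinearRankLE R g s) :
    BilinearRankLE R (fun a b ↦ f a b + g a b) (r + s) := by
  obtain ⟨φ, ψ, w, hf⟩ := hf
  obtain ⟨φ', ψ', w', hg⟩ := hg
  exact ⟨Fin.append φ φ', Fin.append ψ ψ', Fin.append w w', fun a b ↦ by
    simp [Fin.sum_univ_add, hf, hg]⟩

theorem BilinearRankLE.comp {f : V → W → U} {r : ℕ} (hf : BilinearRankLE R f r)
    (S : V' →ₗ[R] V) (T : W' →ₗ[R] W) (N : U →ₗ[R] U') :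
    BilinearRankLE R (fun a b ↦ N (f (S a) (T b))) r := by
  obtain ⟨φ, ψ, w, hf⟩ := hf
  exact ⟨fun k ↦ φ k ∘ₗ S, fun k ↦ ψ k ∘ₗ T, fun k ↦ N (w k), fun a b ↦ by simp [hf]⟩

variable (R) in
/-- Multiplication of `m × n` by `n × p` matrices. -/
def matMul (m n p : ℕ) (A : Matrix (Fin m) (Fin n) R) (B : Matrix (Fin n) (Fin p) R) :
    Matrix (Fin m) (Fin p) R :=
  A * B

/-- Cyclic symmetry of the matrix multiplication tensor. -/
theorem BilinearRankLE.rotate {m n p r : ℕ} (h : BilinearRankLE R (matMul R m n p) r) :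
    BilinearRankLE R (matMul R n p m) r := by
  obtain ⟨φ, ψ, w, h⟩ := h
  refine ⟨ψ, fun k ↦ Matrix.traceLinearMap (Fin m) R R ∘ₗ mulLeftLinearMap (Fin m) R (w k),
    fun k ↦ Matrix.of fun i j ↦ φ k (Matrix.single j i 1), fun B C ↦ ?_⟩
  ext i j
  calc (B * C) i j = (Matrix.single j i (1 : R) * B * C).trace := by
        rw [Matrix.mul_assoc, Matrix.trace_single_mul, one_smul]
    _ = _ := by
        rw [show Matrix.single j i (1 : R) * B = _ from h _ B]
        simp [Matrix.sum_mul, Matrix.trace_sum, Matrix.sum_apply, mul_comm, mul_left_comm]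

variable (R)

/-- The algorithm of Laderman. -/
theorem matMul_three_three_three_rank_le : BilinearRankLE R (matMul R 3 3 3) 23 := by
  let a := Matrix.entryLinearMap R R (m := Fin 3) (n := Fin 3)
  let b := Matrix.entryLinearMap R R (m := Fin 3) (n := Fin 3)
  refine ⟨
    ![a 0 0 + a 0 1 + a 0 2 - a 1 0 - a 1 1 - a 2 1 - a 2 2, a 0 0 - a 1 0, a 1 1,
      -a 0 0 + a 1 0 + a 1 1, a 1 0 + a 1 1, a 0 0, -a 0 0 + a 2 0 + a 2 1, -a 0 0 + a 2 0,
      a 2 0 + a 2 1, a 0 0 + a 0 1 + a 0 2 - a 1 1 - a 1 2 - a 2 0 - a 2 1, a 2 1,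
      -a 0 2 + a 2 1 + a 2 2, a 0 2 - a 2 2, a 0 2, a 2 1 + a 2 2, -a 0 2 + a 1 1 + a 1 2,
      a 0 2 - a 1 2, a 1 1 + a 1 2, a 0 1, a 1 2, a 1 0, a 2 0, a 2 2],
    ![b 1 1, -b 0 1 + b 1 1, -b 0 0 + b 0 1 + b 1 0 - b 1 1 - b 1 2 - b 2 0 + b 2 2,
      b 0 0 - b 0 1 + b 1 1, -b 0 0 + b 0 1, b 0 0, b 0 0 - b 0 2 + b 1 2, b 0 2 - b 1 2,
      -b 0 0 + b 0 2, b 1 2, -b 0 0 + b 0 2 + b 1 0 - b 1 1 - b 1 2 - b 2 0 + b 2 1,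
      b 1 1 + b 2 0 - b 2 1, b 1 1 - b 2 1, b 2 0, -b 2 0 + b 2 1, b 1 2 + b 2 0 - b 2 2,
      b 1 2 - b 2 2, -b 2 0 + b 2 2, b 1 0, b 2 1, b 0 2, b 0 1, b 2 2],
    ![!![0, 1, 0; 0, 0, 0; 0, 0, 0], !![0, 0, 0; 1, 1, 0; 0, 0, 0], !![0, 0, 0; 1, 0, 0; 0, 0, 0],
      !![0, 1, 0; 1, 1, 0; 0, 0, 0], !![0, 1, 0; 0, 1, 0; 0, 0, 0], !![1, 1, 1; 1, 1, 0; 1, 0, 1],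
      !![0, 0, 1; 0, 0, 0; 1, 0, 1], !![0, 0, 0; 0, 0, 0; 1, 0, 1], !![0, 0, 1; 0, 0, 0; 0, 0, 1],
      !![0, 0, 1; 0, 0, 0; 0, 0, 0], !![0, 0, 0; 0, 0, 0; 1, 0, 0], !![0, 1, 0; 0, 0, 0; 1, 1, 0],
      !![0, 0, 0; 0, 0, 0; 1, 1, 0], !![1, 1, 1; 1, 0, 1; 1, 1, 0], !![0, 1, 0; 0, 0, 0; 0, 1, 0],
      !![0, 0, 1; 1, 0, 1; 0, 0, 0], !![0, 0, 0; 1, 0, 1; 0, 0, 0], !![0, 0, 1; 0, 0, 1; 0, 0, 0],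
      !![1, 0, 0; 0, 0, 0; 0, 0, 0], !![0, 0, 0; 0, 1, 0; 0, 0, 0], !![0, 0, 0; 0, 0, 1; 0, 0, 0],
      !![0, 0, 0; 0, 0, 0; 0, 1, 0], !![0, 0, 0; 0, 0, 0; 0, 0, 1]], fun A B ↦ ?_⟩
  ext i j
  fin_cases i <;> fin_cases j <;>
    simp [a, b, matMul, Matrix.mul_apply, Matrix.sum_apply, Fin.sum_univ_succ] <;> ring

/-- An algorithm with the number of multiplications of Hopcroft and Kerr. -/
theorem matMul_three_two_three_rank_le : BilinearRankLE R (matMul R 3 2 3) 15 := by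
  let a := Matrix.entryLinearMap R R (m := Fin 3) (n := Fin 2)
  let b := Matrix.entryLinearMap R R (m := Fin 2) (n := Fin 3)
  refine ⟨
    ![a 2 0 - a 2 1, a 0 1 - a 2 0, a 1 1, a 1 0 - a 2 0, a 0 0 - a 0 1, a 1 1 - a 2 0,
      a 0 1 - a 2 1, a 0 1, a 0 0 - a 0 1 + a 1 0 - a 1 1 - a 2 0 + a 2 1, a 1 1 - a 2 1, a 2 0,
      a 1 0 - a 1 1, a 0 0 - a 2 0, a 0 0 + a 1 0 - a 2 0, a 0 0 + a 1 0 - a 1 1 - a 2 0],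
    ![b 1 2, b 0 1 + b 0 2 + b 1 2, b 0 0 + b 1 0, b 0 0 - b 0 2, b 0 1 + b 0 2, b 0 0 + b 1 2,
      b 1 1, b 0 1 + b 0 2 + b 1 1 + b 1 2, b 1 0 - b 1 1, b 1 0 - b 1 2, b 0 2 + b 1 2, b 0 0,
      b 0 1, b 0 0 - b 0 1 + b 1 0 - b 1 1, b 0 0 + b 1 0 - b 1 1],
    ![!![-1, 0, 0; 0, 0, 0; -1, 0, -1], !![0, -1, 1; 0, 0, 0; 0, -1, 0],
      !![1, 0, 0; 1, 1, 0; 1, 0, 0], !![0, 0, 0; 0, 0, -1; 0, 0, 0],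
      !![0, 0, 1; 0, 0, 0; 0, 0, 0], !![-1, 0, 0; 0, 0, 1; -1, 0, 0],
      !![1, 0, 0; 0, 0, 0; 0, -1, 0], !![0, 1, 0; 0, 0, 0; 0, 1, 0],
      !![-1, 0, 0; 0, 0, 0; 0, 0, 0], !![-1, 0, 0; 0, 0, 0; -1, 0, 0],
      !![0, -1, 1; 0, 0, 1; 0, -1, 1], !![-1, 0, 0; 1, 0, 1; 0, 0, 0],
      !![0, 1, -1; 0, -1, 0; 0, 0, 0], !![0, 0, 0; 0, -1, 0; 0, 0, 0],
      !![1, 0, 0; 0, 1, 0; 0, 0, 0]], fun A B ↦ ?_⟩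
  ext i j
  fin_cases i <;> fin_cases j <;>
    simp [a, b, matMul, Matrix.mul_apply, Matrix.sum_apply, Fin.sum_univ_succ] <;> ring

/-- The algorithm of Strassen for the first two columns of the right factor, and the schoolbook method
for the last one. -/
theorem matMul_two_two_three_rank_le : BilinearRankLE R (matMul R 2 2 3) 11 := by
  let a := Matrix.entryLinearMap R R (m := Fin 2) (n := Fin 2)
  let b := Matrix.entryLinearMap R R (m := Fin 2) (n := Fin 3)
  refine ⟨
    ![a 0 0 + a 1 1, a 1 0 + a 1 1, a 0 0, a 1 1, a 0 0 + a 0 1, -a 0 0 + a 1 0, a 0 1 - a 1 1,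
      a 0 0, a 0 1, a 1 0, a 1 1],
    ![b 0 0 + b 1 1, b 0 0, b 0 1 - b 1 1, -b 0 0 + b 1 0, b 1 1, b 0 0 + b 0 1, b 1 0 + b 1 1,
      b 0 2, b 1 2, b 0 2, b 1 2],
    ![!![1, 0, 0; 0, 1, 0], !![0, 0, 0; 1, -1, 0], !![0, 1, 0; 0, 1, 0], !![1, 0, 0; 1, 0, 0],
      !![-1, 1, 0; 0, 0, 0], !![0, 0, 0; 0, 1, 0], !![1, 0, 0; 0, 0, 0], !![0, 0, 1; 0, 0, 0],
      !![0, 0, 1; 0, 0, 0], !![0, 0, 0; 0, 0, 1], !![0, 0, 0; 0, 0, 1]], fun A B ↦ ?_⟩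
  ext i j
  fin_cases i <;> fin_cases j <;>
    simp [a, b, matMul, Matrix.mul_apply, Matrix.sum_apply, Fin.sum_univ_succ] <;> ring

/-- The linear map `X ↦ P * X * Q`. -/
def sandwich {m n p q : ℕ} (P : Matrix (Fin p) (Fin m) R) (Q : Matrix (Fin n) (Fin q) R) :
    Matrix (Fin m) (Fin n) R →ₗ[R] Matrix (Fin p) (Fin q) R where
  toFun X := P * X * Q
  map_add' X Y := by rw [Matrix.mul_add, Matrix.add_mul]
  map_smul' c X := by simp

theorem sandwich_apply {m n p q : ℕ} (P : Matrix (Fin p) (Fin m) R) (Q : Matrix (Fin n) (Fin q) R)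
    (X : Matrix (Fin m) (Fin n) R) (i : Fin p) (j : Fin q) :
    sandwich R P Q X i j = ∑ l, (∑ k, P i k * X k l) * Q l j := by
  simp [sandwich, Matrix.mul_apply]

open Matrix in
/-- The scheme of Strassen for the splitting `5 = 3 + 2`: `E` and `F` select the two blocks, the second
one padded by zero, and `E'` and `F'` are their first two rows. -/
theorem matMul_five_five_five_rank_le : BilinearRankLE R (matMul R 5 5 5) 101 := by
  have h333 := matMul_three_three_three_rank_le R
  have h323 := matMul_three_two_three_rank_le R
  have h233 := h323.rotate
  have h332 := h233.rotate
  have h223 := matMul_two_two_three_rank_le R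
  have h232 := h223.rotate
  have h322 := h232.rotate
  let E : Matrix (Fin 3) (Fin 5) R := !![1, 0, 0, 0, 0; 0, 1, 0, 0, 0; 0, 0, 1, 0, 0]
  let F : Matrix (Fin 3) (Fin 5) R := !![0, 0, 0, 1, 0; 0, 0, 0, 0, 1; 0, 0, 0, 0, 0]
  let E' : Matrix (Fin 2) (Fin 5) R := !![1, 0, 0, 0, 0; 0, 1, 0, 0, 0]
  let F' : Matrix (Fin 2) (Fin 5) R := !![0, 0, 0, 1, 0; 0, 0, 0, 0, 1]
  have H := (((((((h333.comp (sandwich R E Eᵀ + sandwich R F Fᵀ)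
      (sandwich R E Eᵀ + sandwich R F Fᵀ) (sandwich R Eᵀ E + sandwich R Fᵀ F)).add
    (h233.comp (sandwich R F' (E + F)ᵀ) (sandwich R E Eᵀ) (sandwich R F'ᵀ (E - F)))).add
    (h332.comp (sandwich R E Eᵀ) (sandwich R (E - F) F'ᵀ) (sandwich R (E + F)ᵀ F'))).add
    (h223.comp (sandwich R F' F'ᵀ) (sandwich R (F' - E') Eᵀ) (sandwich R (E' + F')ᵀ E))).add
    (h322.comp (sandwich R E (E' + F')ᵀ) (sandwich R F' F'ᵀ) (sandwich R Eᵀ (F' - E')))).add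
    (h232.comp (sandwich R (F' - E') Eᵀ) (sandwich R E (E' + F')ᵀ) (sandwich R F'ᵀ F'))).add
    (h323.comp (sandwich R (E - F) F'ᵀ) (sandwich R F' (E + F)ᵀ) (sandwich R Eᵀ E)))
  convert H using 1
  funext A B
  rw [← Matrix.ext_iff]
  simp [Fin.forall_fin_succ, E, F, E', F', sandwich_apply, matMul, Matrix.mul_apply,
    Fin.sum_univ_five, Fin.sum_univ_three]
  refine ⟨⟨?_, ?_, ?_, ?_, ?_⟩, ⟨?_, ?_, ?_, ?_, ?_⟩, ⟨?_, ?_, ?_, ?_, ?_⟩, ⟨?_, ?_, ?_, ?_, ?_⟩,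
    ?_, ?_, ?_, ?_, ?_⟩ <;> ring

end BilinearRank

/-- The 5×5 matrix multiplication map over ℚ has bilinear complexity at most 101. -/
theorem rank_matmul_5x5_le_101 :
    ∃ (φ ψ : Fin 101 → (Matrix (Fin 5) (Fin 5) ℚ →ₗ[ℚ] ℚ))
      (W : Fin 101 → Matrix (Fin 5) (Fin 5) ℚ),
      ∀ A B : Matrix (Fin 5) (Fin 5) ℚ,
        A * B = ∑ k : Fin 101, (φ k A * ψ k B) • W k := by
  exact matMul_five_five_five_rank_le ℚ
end

section
/- The 5×5 matrix multiplication map over the rational numbers has bilinear complexity at most 100: there exist 100 linear forms φ₁,…,φ₁₀₀ on 5×5 rational matrices, 100 linear forms ψ₁,…,ψ₁₀₀ on 5×5 rational matrices, and 100 fixed 5×5 rational matrices W₁,…,W₁₀₀ such that A·B = Σ_{k=1}^{100} φ_k(A)·ψ_k(B)·W_k for all 5×5 rational matrices A and B. -/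
namespace MatMulFive

/-- The entry `(i, j)` of the `5 × 5` matrix encoded by `m`: the base-three digit of `m` at position
`5 * i + j`, where the digit `2` stands for `-1`. -/
def trit (m : ℕ) (i j : Fin 5) : ℤ :=
  match m / 3 ^ (5 * i.val + j.val) % 3 with
  | 0 => 0
  | 1 => 1
  | _ => -1

/-- Representatives of the orbits of length three, under cyclic rotation of the tensor factors, in a
decomposition of the trilinear form `tr (A * B * C)`; matrices are encoded as in `trit`. -/
def cyclicOrbits : List (ℕ × ℕ × ℕ) := [
  (2367569742, 303350242887, 3486902499),
  (14349636, 8993, 1830573),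
  (130203045, 2125764, 387420489),
  (13122, 405076140, 139471385840),
  (577617336, 59778, 6806),
  (39447, 10460353203, 3486804327),
  (2367569742, 303350778702, 59049),
  (382384042326, 31382124678, 4842018),
  (188287433658, 400293171, 413765101935),
  (760119052501, 578680200, 59049),
  (573956360, 303351325452, 390609380),
  (157464, 380059519554, 32530804875),
  (305717833683, 8748, 1653426),
  (7750004590, 573956360, 303351326181),
  (411450144939, 94143185388, 1576903545),
  (6436395, 305674785504, 3486801897),
  (391081527, 14366889, 531468),
  (19683, 282429556326, 140619298320),
  (188292807117, 1162300833, 129011022837),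
  (303360007113, 6561, 129140181),
  (188288201295, 14368590, 411440579163),
  (575319465612, 3486785373, 19684),
  (64468167300, 4822335, 97629963228),
  (891462753, 77031, 27),
  (413808157727, 538002, 390727233),
  (972, 1, 303350264193),
  (3486797523, 1706043726, 303359828508),
  (3667599, 14348907, 411440588228),
  (236196, 14362515, 531459),
  (1063611, 3877393536, 573956360)]

/-- The rotation-invariant terms `a ⊗ a ⊗ a` of the decomposition. -/
def cubes : List ℕ := [730, 387951930, 282429536481]

/-- The decomposition of `tr (A * B * C)` into 93 rank-one terms, padded with zeros to length 100. -/
def terms : List (ℕ × ℕ × ℕ) :=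
  (cyclicOrbits.flatMap fun (a, b, c) => [(a, b, c), (b, c, a), (c, a, b)]) ++
    cubes.map (fun a => (a, a, a)) ++ List.replicate 7 (0, 0, 0)

lemma length_terms : terms.length = 100 := by decide +kernel

lemma sum_map_filter_ne_zero {ι R : Type*} [AddMonoid R] [DecidableEq R] {l : List ι}
    {u f : ι → R} (h : ∀ t, u t = 0 → f t = 0) :
    ((l.filter fun t => u t ≠ 0).map f).sum = (l.map f).sum := by
  induction l with
  | nil => rfl
  | cons t l ih =>
    by_cases ht : u t = 0
    · simpa [ht, h t ht] using ih
    · simpa [ht] using congrArg (f t + ·) ih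

/-- The Brent equations, with the vanishing summands filtered out to speed up evaluation. -/
lemma sum_filter_terms : ∀ i j k l p q : Fin 5,
    (((terms.filter fun t => trit t.1 i j ≠ 0).filter fun t => trit t.2.1 k l ≠ 0).map
      fun t => trit t.1 i j * trit t.2.1 k l * trit t.2.2 p q).sum =
      if j = k ∧ l = p ∧ q = i then 1 else 0 := by
  decide +kernel

/-- The Brent equations for `terms`. -/
lemma sum_terms (i j k l p q : Fin 5) :
    (terms.map fun t => trit t.1 i j * trit t.2.1 k l * trit t.2.2 p q).sum =
      if j = k ∧ l = p ∧ q = i then 1 else 0 := by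
  rw [← sum_filter_terms, sum_map_filter_ne_zero fun t ht => by simp [ht],
    sum_map_filter_ne_zero fun t ht => by simp [ht]]

/-- The `k`-th term of the decomposition. -/
def term (k : Fin 100) : ℕ × ℕ × ℕ := terms.get (k.cast length_terms.symm)

lemma sum_term (i j k l p q : Fin 5) :
    ∑ s, (trit (term s).1 i j * trit (term s).2.1 k l * trit (term s).2.2 p q : ℚ) =
      if j = k ∧ l = p ∧ q = i then 1 else 0 := by
  have h := sum_terms i j k l p q
  rw [← Fin.sum_univ_fun_getElem, ← (finCongr length_terms.symm).sum_comp] at h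
  exact_mod_cast congrArg (Int.cast : ℤ → ℚ) h

/-- The linear form on `5 × 5` matrices with the coefficients encoded by `m`. -/
def form (m : ℕ) : Matrix (Fin 5) (Fin 5) ℚ →ₗ[ℚ] ℚ :=
  ∑ i, ∑ j, (trit m i j : ℚ) • Matrix.entryLinearMap ℚ ℚ i j

lemma form_apply (m : ℕ) (A : Matrix (Fin 5) (Fin 5) ℚ) :
    form m A = ∑ x : Fin 5 × Fin 5, (trit m x.1 x.2 : ℚ) * A x.1 x.2 := by
  simp [form, Fintype.sum_prod_type]

end MatMulFive

open MatMulFive in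

/-- The 5×5 matrix multiplication map over ℚ has bilinear complexity at most 100. -/
theorem rank_matmul_5x5_le_100 :
    ∃ (φ ψ : Fin 100 → (Matrix (Fin 5) (Fin 5) ℚ →ₗ[ℚ] ℚ))
      (W : Fin 100 → Matrix (Fin 5) (Fin 5) ℚ),
      ∀ A B : Matrix (Fin 5) (Fin 5) ℚ,
        A * B = ∑ k : Fin 100, (φ k A * ψ k B) • W k := by
  refine ⟨fun k => form (term k).1, fun k => form (term k).2.1,
    fun k => Matrix.of fun i l => (trit (term k).2.2 l i : ℚ), fun A B => ?_⟩
  ext i l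
  have key : ∀ x y : Fin 5 × Fin 5,
      ∑ s, (trit (term s).1 x.1 x.2 : ℚ) * A x.1 x.2 * (trit (term s).2.1 y.1 y.2 * B y.1 y.2) *
        trit (term s).2.2 l i =
      A x.1 x.2 * B y.1 y.2 * if x.2 = y.1 ∧ y.2 = l ∧ i = x.1 then 1 else 0 := by
    intro x y
    rw [← sum_term, Finset.mul_sum]
    exact Finset.sum_congr rfl fun s _ => by ring
  calc (A * B) i l
      = ∑ x : Fin 5 × Fin 5, ∑ y : Fin 5 × Fin 5,
          A x.1 x.2 * B y.1 y.2 * if x.2 = y.1 ∧ y.2 = l ∧ i = x.1 then 1 else 0 := by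
        simp [Matrix.mul_apply, Fintype.sum_prod_type, ite_and]
    _ = ∑ s, (form (term s).1 A * form (term s).2.1 B) * (trit (term s).2.2 l i : ℚ) := by
        simp_rw [← key, form_apply, Finset.sum_mul_sum, Finset.sum_mul]
        simp_rw [Finset.sum_comm (s := (Finset.univ : Finset (Fin 5 × Fin 5)))
          (t := (Finset.univ : Finset (Fin 100)))]
    _ = _ := by simp [Matrix.sum_apply]
end

section
/- The 10×10 matrix multiplication map over the rational numbers has bilinear complexity at most 693: there exist 693 linear forms φ₁,…,φ₆₉₃ on 10×10 rational matrices, 693 linear forms ψ₁,…,ψ₆₉₃ on 10×10 rational matrices, and 693 fixed 10×10 rational matrices W₁,…,W₆₉₃ such that A·B = Σ_{k=1}^{693} φ_k(A)·ψ_k(B)·W_k for all 10×10 rational matrices A and B. -/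
/-- The matrices `u t`, `v t`, `w t` form a decomposition of the trilinear form
`(A, B, C) ↦ trace (A * B * C)` on square matrices into `Fintype.card ι` rank-one terms. -/
def IsTraceDecomposition {n ι R : Type*} [DecidableEq n] [Fintype ι] [CommSemiring R]
    (u v w : ι → Matrix n n R) : Prop :=
  ∀ i j k l p q, ∑ t, u t i j * v t k l * w t p q = if j = k ∧ l = p ∧ q = i then 1 else 0

namespace IsTraceDecomposition

variable {m n ι κ R S : Type*} [DecidableEq m] [DecidableEq n] [Fintype ι] [Fintype κ]

theorem map [CommSemiring R] [CommSemiring S] (f : R →+* S) {u v w : ι → Matrix n n R}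
    (h : IsTraceDecomposition u v w) :
    IsTraceDecomposition (fun t => (u t).map f) (fun t => (v t).map f) (fun t => (w t).map f) := by
  intro i j k l p q
  simp only [Matrix.map_apply, ← map_mul, ← map_sum, h i j k l p q]
  split_ifs <;> simp

theorem reindex [CommSemiring R] (e : ι ≃ κ) (g : m ≃ n) {u v w : ι → Matrix m m R}
    (h : IsTraceDecomposition u v w) :
    IsTraceDecomposition (fun t => (u (e.symm t)).reindex g g)
      (fun t => (v (e.symm t)).reindex g g) (fun t => (w (e.symm t)).reindex g g) := by
  intro i j k l p q
  simpa [← e.symm.sum_comp] using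
    h (g.symm i) (g.symm j) (g.symm k) (g.symm l) (g.symm p) (g.symm q)

open scoped Kronecker in
theorem kronecker [CommSemiring R] {u v w : ι → Matrix m m R} {u' v' w' : κ → Matrix n n R}
    (h : IsTraceDecomposition u v w) (h' : IsTraceDecomposition u' v' w') :
    IsTraceDecomposition (fun t : ι × κ => u t.1 ⊗ₖ u' t.2) (fun t => v t.1 ⊗ₖ v' t.2)
      (fun t => w t.1 ⊗ₖ w' t.2) := by
  rintro ⟨i, i'⟩ ⟨j, j'⟩ ⟨k, k'⟩ ⟨l, l'⟩ ⟨p, p'⟩ ⟨q, q'⟩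
  calc
    _ = ∑ t : ι × κ, (u t.1 i j * v t.1 k l * w t.1 p q) *
          (u' t.2 i' j' * v' t.2 k' l' * w' t.2 p' q') :=
        Finset.sum_congr rfl fun t _ => by simp only [Matrix.kronecker_apply]; ring
    _ = (∑ t, u t i j * v t k l * w t p q) * ∑ t, u' t i' j' * v' t k' l' * w' t p' q' := by
        rw [Fintype.sum_prod_type, Finset.sum_mul_sum]
  rw [h, h', ite_zero_mul_ite_zero, mul_one]
  simp only [Prod.mk.injEq]
  congr 1
  simp only [eq_iff_iff]
  tauto

theorem mul_eq_sum [Fintype n] [CommSemiring R] {u v w : ι → Matrix n n R}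
    (h : IsTraceDecomposition u v w) (A B : Matrix n n R) :
    A * B = ∑ t, ((∑ i, ∑ j, u t i j * A i j) * ∑ k, ∑ l, v t k l * B k l) • (w t).transpose := by
  ext q p
  simp only [Matrix.sum_apply, Matrix.smul_apply, Matrix.transpose_apply, smul_eq_mul]
  calc (A * B) q p
      = ∑ i, ∑ j, ∑ k, ∑ l, (if j = k ∧ l = p ∧ q = i then 1 else 0) * (A i j * B k l) := by
        simp [Matrix.mul_apply, ite_and]
    _ = ∑ i, ∑ j, ∑ k, ∑ l, ∑ t, u t i j * v t k l * w t p q * (A i j * B k l) := by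
        simp only [← h _ _ _ _ _ _, Finset.sum_mul]
    _ = ∑ t, ∑ i, ∑ j, ∑ k, ∑ l, u t i j * v t k l * w t p q * (A i j * B k l) := by
        simp only [Finset.sum_comm (t := (Finset.univ : Finset ι))]
    _ = _ := by
        refine Finset.sum_congr rfl fun t _ => ?_
        simp only [Finset.sum_mul]
        simp only [Finset.mul_sum]
        simp only [Finset.sum_mul]
        refine Finset.sum_congr rfl fun i _ => Finset.sum_congr rfl fun j _ =>
          Finset.sum_congr rfl fun k _ => Finset.sum_congr rfl fun l _ => by ring

theorem exists_bilinear_algorithm [Fintype n] [CommRing R] {u v w : ι → Matrix n n R}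
    (h : IsTraceDecomposition u v w) :
    ∃ (φ ψ : ι → (Matrix n n R →ₗ[R] R)) (W : ι → Matrix n n R),
      ∀ A B : Matrix n n R, A * B = ∑ t, (φ t A * ψ t B) • W t := by
  let form (M : Matrix n n R) : Matrix n n R →ₗ[R] R :=
    { toFun := fun A => ∑ i, ∑ j, M i j * A i j
      map_add' := fun A B => by simp [mul_add, Finset.sum_add_distrib]
      map_smul' := fun c A => by simp [Finset.mul_sum, mul_left_comm] }
  exact ⟨fun t => form (u t), fun t => form (v t), fun t => (w t).transpose, h.mul_eq_sum⟩

end IsTraceDecomposition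

/-- The `x`-th base-three digit of `c`, with the digit `2` read as `-1`. -/
def ternaryDigit (c x : ℕ) : ℤ :=
  match c / 3 ^ x % 3 with
  | 0 => 0
  | 1 => 1
  | _ => -1

/-- The `n × n` matrix whose entries, row by row, are the ternary digits of `c`. -/
def ternaryMatrix (n c : ℕ) : Matrix (Fin n) (Fin n) ℤ :=
  Matrix.of fun i j => ternaryDigit c (n * i + j)

/-- The cubes `a ⊗ a ⊗ a` for `a` in the first list, followed by the three cyclic rotations of each
triple in the second list. -/
def cyclicTerms (cubes : List ℕ) (orbits : List (ℕ × ℕ × ℕ)) : List (ℕ × ℕ × ℕ) :=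
  cubes.map (fun a => (a, a, a)) ++
    orbits.flatMap fun (a, b, c) => [(a, b, c), (b, c, a), (c, a, b)]

/-- The sum of the products of the entries of `L` at the positions `x`, `y`, `z`, skipping the
terms whose first or second factor vanishes. -/
def sparseSum (L : List (ℕ × ℕ × ℕ)) (x y z : ℕ) : ℤ :=
  (((L.filter fun t => ternaryDigit t.1 x ≠ 0).filter fun t => ternaryDigit t.2.1 y ≠ 0).map
    fun t => ternaryDigit t.1 x * ternaryDigit t.2.1 y * ternaryDigit t.2.2 z).sum

theorem List.sum_map_filter_of_eq_zero {α M : Type*} [AddMonoid M] (p : α → Bool) (f : α → M)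
    (hf : ∀ a, p a = false → f a = 0) (L : List α) : ((L.filter p).map f).sum = (L.map f).sum := by
  induction L with
  | nil => rfl
  | cons a L ih => cases h : p a <;> simp [h, ih, hf]

theorem sparseSum_eq (L : List (ℕ × ℕ × ℕ)) (x y z : ℕ) :
    sparseSum L x y z =
      (L.map fun t => ternaryDigit t.1 x * ternaryDigit t.2.1 y * ternaryDigit t.2.2 z).sum := by
  rw [sparseSum, List.sum_map_filter_of_eq_zero, List.sum_map_filter_of_eq_zero] <;>
  · intro t ht
    simp_all

theorem isTraceDecomposition_of_sparseSum {n : ℕ} (L : List (ℕ × ℕ × ℕ))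
    (h : ∀ i j k l p q : Fin n, sparseSum L (n * i + j) (n * k + l) (n * p + q) =
      if j = k ∧ l = p ∧ q = i then 1 else 0) :
    IsTraceDecomposition (fun t : Fin L.length => ternaryMatrix n L[t].1)
      (fun t => ternaryMatrix n L[t].2.1) (fun t => ternaryMatrix n L[t].2.2) := by
  intro i j k l p q
  rw [← h, sparseSum_eq, ← Fin.sum_univ_fun_getElem]
  rfl

/-- A cyclically symmetric form of Strassen's decomposition of 2×2 matrix multiplication into 7
terms. -/
def strassenTerms : List (ℕ × ℕ × ℕ) :=
  cyclicTerms [28]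
    [(57, 36, 1),
     (11, 4, 27)]

/-- A cyclically symmetric decomposition of 5×5 matrix multiplication into 99 terms. -/
def fiveByFiveTerms : List (ℕ × ℕ × ℕ) :=
  cyclicTerms [532171, 387420489, 282429536481]
    [(289403105445, 105078817431, 4802652),
     (188289569871, 2329325586, 55788550416),
     (17496, 401769396, 362625577882),
     (81, 34867844010, 3491649990),
     (10503399924, 5103, 813104811),
     (944784, 3201795, 903981141),
     (1639332, 354494550087, 3488024430),
     (355026645486, 1240029, 3188673),
     (806799852, 885756, 729),
     (1600886, 818773455, 591219),
     (352165224673, 4446900, 3888),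
     (73697226381, 4806540, 756632215098),
     (362630360673, 94144779711, 1564030863),
     (813144096, 620647623459, 188289547029),
     (3344535375, 352170007470, 3488385285),
     (188289546300, 387420489, 2334128319),
     (54168009660, 4782969, 191773142055),
     (3486784401, 104603532060, 352170027153),
     (1, 821430669, 592920),
     (5103, 402950386, 43224597),
     (23571, 385875609696, 73223712450),
     (54, 387420489, 2579423476),
     (756632215127, 817887699, 3888),
     (3487848741, 9728992, 599726917053),
     (1604529, 401887495, 352208449276),
     (599823522597, 1600884, 14467006),
     (2549361945, 1594350, 387420489),
     (107954503904, 599726916972, 3486784401),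
     (4269024, 123688, 352165224673),
     (402955236, 885736, 3189402),
     (3645, 815762079, 43046721),
     (352171188450, 1600884, 316679809)]

theorem isTraceDecomposition_strassenTerms :
    IsTraceDecomposition (fun t : Fin strassenTerms.length => ternaryMatrix 2 strassenTerms[t].1)
      (fun t => ternaryMatrix 2 strassenTerms[t].2.1)
      (fun t => ternaryMatrix 2 strassenTerms[t].2.2) :=
  isTraceDecomposition_of_sparseSum _ (by decide +kernel)

theorem isTraceDecomposition_fiveByFiveTerms :
    IsTraceDecomposition
      (fun t : Fin fiveByFiveTerms.length => ternaryMatrix 5 fiveByFiveTerms[t].1)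
      (fun t => ternaryMatrix 5 fiveByFiveTerms[t].2.1)
      (fun t => ternaryMatrix 5 fiveByFiveTerms[t].2.2) :=
  isTraceDecomposition_of_sparseSum _ (by decide +kernel)

/-- The 10×10 matrix multiplication map over ℚ has bilinear complexity at most 693. -/
theorem rank_matmul_10x10_le_693 :
    ∃ (φ ψ : Fin 693 → (Matrix (Fin 10) (Fin 10) ℚ →ₗ[ℚ] ℚ))
      (W : Fin 693 → Matrix (Fin 10) (Fin 10) ℚ),
      ∀ A B : Matrix (Fin 10) (Fin 10) ℚ,
        A * B = ∑ k : Fin 693, (φ k A * ψ k B) • W k := by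
  have e : Fin strassenTerms.length × Fin fiveByFiveTerms.length ≃ Fin 693 :=
    finProdFinEquiv.trans (finCongr (by decide +kernel))
  exact (((isTraceDecomposition_strassenTerms.kronecker isTraceDecomposition_fiveByFiveTerms).map
    (Int.castRingHom ℚ)).reindex e finProdFinEquiv).exists_bilinear_algorithm
end

section
/- Bilinear complexity of square matrix multiplication is submultiplicative under composition: if over a field K the m×m matrix multiplication map admits a bilinear algorithm using r coefficient multiplications and the n×n matrix multiplication map admits a bilinear algorithm using s coefficient multiplications, then the (m·n)×(m·n) matrix multiplication map over K admits a bilinear algorithm using r·s coefficient multiplications. -/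
/-- Apply a linear form on `I × I` matrices to each `I × I` block of a matrix indexed by `I × J`. -/
def Matrix.mapBlocks {K I : Type*} (J : Type*) [CommSemiring K]
    (φ : Matrix I I K →ₗ[K] K) : Matrix (I × J) (I × J) K →ₗ[K] Matrix J J K where
  toFun A := Matrix.of fun j j' => φ (Matrix.of fun i i' => A (i, j) (i', j'))
  map_add' A B := by
    ext j j'
    exact map_add φ (Matrix.of fun i i' => A (i, j) (i', j'))
      (Matrix.of fun i i' => B (i, j) (i', j'))
  map_smul' c A := by
    ext j j'
    exact map_smul φ c (Matrix.of fun i i' => A (i, j) (i', j'))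

/-- A bilinear algorithm for `I × I` matrix multiplication, applied blockwise. -/
theorem Matrix.mul_apply_eq_sum_mapBlocks {K I J ι : Type*} [CommSemiring K]
    [Fintype I] [Fintype J] [Fintype ι] (φ ψ : ι → (Matrix I I K →ₗ[K] K))
    (W : ι → Matrix I I K) (h : ∀ A B : Matrix I I K, A * B = ∑ k, (φ k A * ψ k B) • W k)
    (A B : Matrix (I × J) (I × J) K) (i i' : I) (j j' : J) :
    (A * B) (i, j) (i', j') =
      ∑ k, (Matrix.mapBlocks J (φ k) A * Matrix.mapBlocks J (ψ k) B) j j' * W k i i' := by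
  have block (c : J) := congrFun (congrFun (h (Matrix.of fun a b => A (a, j) (b, c))
    (Matrix.of fun a b => B (a, c) (b, j'))) i) i'
  simp only [Matrix.mul_apply, Matrix.sum_apply, Matrix.smul_apply, smul_eq_mul,
    Matrix.of_apply] at block
  simp only [Matrix.mul_apply, Fintype.sum_prod_type_right, block, Finset.sum_mul]
  exact Finset.sum_comm

/-- Composing bilinear algorithms for `I × I` and `J × J` matrix multiplication gives one for
matrices indexed by `I × J`, with outputs the Kronecker products of the outputs. -/
theorem Matrix.mul_eq_sum_mapBlocks_smul_kronecker {K I J ι κ : Type*} [CommSemiring K]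
    [Fintype I] [Fintype J] [Fintype ι] [Fintype κ]
    (φ ψ : ι → (Matrix I I K →ₗ[K] K)) (W : ι → Matrix I I K)
    (h : ∀ A B : Matrix I I K, A * B = ∑ k, (φ k A * ψ k B) • W k)
    (φ' ψ' : κ → (Matrix J J K →ₗ[K] K)) (W' : κ → Matrix J J K)
    (h' : ∀ A B : Matrix J J K, A * B = ∑ l, (φ' l A * ψ' l B) • W' l)
    (A B : Matrix (I × J) (I × J) K) :
    A * B = ∑ p : ι × κ, (φ' p.2 (Matrix.mapBlocks J (φ p.1) A) *
      ψ' p.2 (Matrix.mapBlocks J (ψ p.1) B)) • Matrix.kroneckerMap (· * ·) (W p.1) (W' p.2) := by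
  ext ⟨i, j⟩ ⟨i', j'⟩
  rw [Matrix.mul_apply_eq_sum_mapBlocks φ ψ W h]
  simp only [h', Matrix.sum_apply, Matrix.smul_apply, smul_eq_mul, Fintype.sum_prod_type,
    Finset.sum_mul, Matrix.kroneckerMap_apply]
  exact Finset.sum_congr rfl fun _ _ => Finset.sum_congr rfl fun _ _ => by ring

/-- Bilinear complexity of square matrix multiplication is submultiplicative under
composition: if `m×m` matrix multiplication over a field `K` admits a bilinear algorithm
using `r` multiplications and `n×n` matrix multiplication admits one using `s`
multiplications, then `(m·n)×(m·n)` matrix multiplication admits one using `r·s`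
multiplications. -/
theorem matmul_bilinear_complexity_submultiplicative
    (K : Type*) [Field K] (m n r s : ℕ)
    (hm : ∃ (φ ψ : Fin r → (Matrix (Fin m) (Fin m) K →ₗ[K] K))
            (W : Fin r → Matrix (Fin m) (Fin m) K),
            ∀ A B : Matrix (Fin m) (Fin m) K,
              A * B = ∑ k : Fin r, (φ k A * ψ k B) • W k)
    (hn : ∃ (φ ψ : Fin s → (Matrix (Fin n) (Fin n) K →ₗ[K] K))
            (W : Fin s → Matrix (Fin n) (Fin n) K),
            ∀ A B : Matrix (Fin n) (Fin n) K,
              A * B = ∑ k : Fin s, (φ k A * ψ k B) • W k) :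
    ∃ (φ ψ : Fin (r * s) → (Matrix (Fin (m * n)) (Fin (m * n)) K →ₗ[K] K))
      (W : Fin (r * s) → Matrix (Fin (m * n)) (Fin (m * n)) K),
      ∀ A B : Matrix (Fin (m * n)) (Fin (m * n)) K,
        A * B = ∑ k : Fin (r * s), (φ k A * ψ k B) • W k := by
  obtain ⟨φ, ψ, W, h⟩ := hm
  obtain ⟨φ', ψ', W', h'⟩ := hn
  let e : Matrix (Fin (m * n)) (Fin (m * n)) K ≃ₗ[K]
      Matrix (Fin m × Fin n) (Fin m × Fin n) K :=
    Matrix.reindexLinearEquiv K K finProdFinEquiv.symm finProdFinEquiv.symm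
  let f : Fin (r * s) ≃ Fin r × Fin s := finProdFinEquiv.symm
  refine ⟨fun k => φ' (f k).2 ∘ₗ Matrix.mapBlocks (Fin n) (φ (f k).1) ∘ₗ e.toLinearMap,
    fun k => ψ' (f k).2 ∘ₗ Matrix.mapBlocks (Fin n) (ψ (f k).1) ∘ₗ e.toLinearMap,
    fun k => e.symm (Matrix.kroneckerMap (· * ·) (W (f k).1) (W' (f k).2)), fun A B => e.injective ?_⟩
  have he : e (A * B) = e A * e B :=
    (Matrix.reindexLinearEquiv_mul K K _ _ _ A B).symm
  rw [he, Matrix.mul_eq_sum_mapBlocks_smul_kronecker φ ψ W h φ' ψ' W' h', map_sum,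
    ← f.sum_comp]
  simp
end

section
/- (Hopcroft–Kerr) For every commutative ring K, the 2×2 by 2×3 matrix multiplication map over K admits a bilinear algorithm using 11 coefficient multiplications: there exist 11 linear forms φ₁,…,φ₁₁ on 2×2 matrices over K, 11 linear forms ψ₁,…,ψ₁₁ on 2×3 matrices over K, and 11 fixed 2×3 matrices W₁,…,W₁₁ over K such that A·B = Σ_{k=1}^{11} φ_k(A)·ψ_k(B)·W_k for all 2×2 matrices A and 2×3 matrices B over K. -/
/-- Hopcroft–Kerr: for every commutative ring `K`, the 2×2 by 2×3 matrix multiplication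
map over `K` admits a bilinear algorithm using 11 coefficient multiplications. -/
theorem hopcroft_kerr_2x2x3_algorithm_with_11_mults (K : Type*) [CommRing K] :
    ∃ (φ : Fin 11 → (Matrix (Fin 2) (Fin 2) K →ₗ[K] K))
      (ψ : Fin 11 → (Matrix (Fin 2) (Fin 3) K →ₗ[K] K))
      (W : Fin 11 → Matrix (Fin 2) (Fin 3) K),
      ∀ (A : Matrix (Fin 2) (Fin 2) K) (B : Matrix (Fin 2) (Fin 3) K),
        A * B = ∑ k : Fin 11, (φ k A * ψ k B) • W k := by
  -- The seven Strassen products for the first two columns, four direct products for the third.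
  let a (i j : Fin 2) : Matrix (Fin 2) (Fin 2) K →ₗ[K] K := Matrix.entryLinearMap K K i j
  let b (i : Fin 2) (j : Fin 3) : Matrix (Fin 2) (Fin 3) K →ₗ[K] K :=
    Matrix.entryLinearMap K K i j
  refine ⟨![a 0 0 + a 1 1, a 1 0 + a 1 1, a 0 0, a 1 1, a 0 0 + a 0 1, a 1 0 - a 0 0,
      a 0 1 - a 1 1, a 0 0, a 0 1, a 1 0, a 1 1],
    ![b 0 0 + b 1 1, b 0 0, b 0 1 - b 1 1, b 1 0 - b 0 0, b 1 1, b 0 0 + b 0 1,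
      b 1 0 + b 1 1, b 0 2, b 1 2, b 0 2, b 1 2],
    ![!![1, 0, 0; 0, 1, 0], !![0, 0, 0; 1, -1, 0], !![0, 1, 0; 0, 1, 0],
      !![1, 0, 0; 1, 0, 0], !![-1, 1, 0; 0, 0, 0], !![0, 0, 0; 0, 1, 0],
      !![1, 0, 0; 0, 0, 0], !![0, 0, 1; 0, 0, 0], !![0, 0, 1; 0, 0, 0],
      !![0, 0, 0; 0, 0, 1], !![0, 0, 0; 0, 0, 1]], fun A B => ?_⟩
  ext i j
  fin_cases i <;> fin_cases j <;>
    simp [a, b, Matrix.mul_apply, Fin.sum_univ_succ] <;> ring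
end

section
/- (Hopcroft–Kerr) For every commutative ring K, the 3×3 by 3×2 matrix multiplication map over K admits a bilinear algorithm using 15 coefficient multiplications: there exist 15 linear forms φ₁,…,φ₁₅ on 3×3 matrices over K, 15 linear forms ψ₁,…,ψ₁₅ on 3×2 matrices over K, and 15 fixed 3×2 matrices W₁,…,W₁₅ over K such that A·B = Σ_{k=1}^{15} φ_k(A)·ψ_k(B)·W_k for all 3×3 matrices A and 3×2 matrices B over K. -/
/-- The linear form on matrices with integer coefficients `c`, that is,
`A ↦ ∑ i, ∑ j, c i j * A i j`. -/
def Matrix.intCoeffForm {m n : Type*} [Fintype m] [Fintype n] (K : Type*) [CommRing K]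
    (c : Matrix m n ℤ) : Matrix m n K →ₗ[K] K where
  toFun A := ∑ i, ∑ j, (c i j : K) * A i j
  map_add' A B := by simp [mul_add, Finset.sum_add_distrib]
  map_smul' r A := by simp [Finset.mul_sum, mul_left_comm]

lemma Matrix.intCoeffForm_apply {m n : Type*} [Fintype m] [Fintype n] (K : Type*) [CommRing K]
    (c : Matrix m n ℤ) (A : Matrix m n K) :
    Matrix.intCoeffForm K c A = ∑ i, ∑ j, (c i j : K) * A i j := rfl

namespace HopcroftKerr

/-- Coefficients of the linear forms applied to the left factor. -/
def leftCoeff : Fin 15 → Matrix (Fin 3) (Fin 3) ℤ :=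
  ![!![1, 0, -1; 0, 0, 0; 0, 0, 0],
    !![0, 0, 0; 1, 1, 0; 0, 0, -1],
    !![0, 0, 0; -1, -1, 0; 0, 1, 1],
    !![1, 0, -1; 1, 0, 0; -1, 0, 0],
    !![0, 0, 0; -1, 0, 0; 0, 0, 1],
    !![0, 0, 0; 0, 0, -1; 0, 0, 1],
    !![0, 0, 0; -1, 0, 1; 0, 0, 0],
    !![0, 0, -1; 1, 1, 0; 0, 0, 0],
    !![-1, -1, 1; -1, -1, 0; 1, 1, 0],
    !![1, 0, -1; 1, 1, 0; -1, -1, 0],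
    !![0, 0, 0; 1, 1, 0; -1, -1, 0],
    !![0, 0, -1; 1, 0, 0; 0, 0, 0],
    !![0, 0, -1; 0, 0, 0; 0, 0, 0],
    !![0, 0, 0; -1, -1, 0; 0, 0, 0],
    !![0, -1, -1; 1, 1, 0; 0, 0, 0]]

/-- Coefficients of the linear forms applied to the right factor. -/
def rightCoeff : Fin 15 → Matrix (Fin 3) (Fin 2) ℤ :=
  ![!![1, -1; 0, 0; 0, 0],
    !![-1, 0; 1, 0; -1, 0],
    !![1, 0; -1, 0; 0, 0],
    !![0, 1; 0, -1; 0, 0],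
    !![1, 0; -1, 0; 1, -1],
    !![0, 0; 0, 0; 0, -1],
    !![0, 0; 0, 0; -1, 1],
    !![-1, 0; 1, -1; -1, 0],
    !![0, 0; 0, -1; 0, 0],
    !![-1, 0; 0, 1; 0, 0],
    !![1, 0; 0, 0; 0, 0],
    !![-1, 1; 1, -1; -1, 1],
    !![0, 1; 0, 0; 0, 1],
    !![-1, 0; 0, 0; -1, 0],
    !![0, 0; -1, 1; 0, 0]]

/-- The matrices by which the fifteen products are recombined. -/
def outCoeff : Fin 15 → Matrix (Fin 3) (Fin 2) ℤ :=
  ![!![0, -1; 0, 0; 0, -1],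
    !![0, 0; 1, 1; 1, 1],
    !![0, 0; 0, 0; -1, 0],
    !![0, 0; 0, 0; 0, -1],
    !![0, 0; -1, -1; 0, -1],
    !![0, 0; 1, 1; 0, 0],
    !![0, 0; -1, 0; 0, 0],
    !![1, 0; 0, -1; 0, -1],
    !![1, 1; 0, 0; 0, 0],
    !![-1, -1; 0, 0; 0, -1],
    !![-1, -1; 0, 0; -1, -1],
    !![0, 0; 0, 1; 0, 1],
    !![0, -1; 0, -1; 0, -1],
    !![1, 0; 1, 0; 1, 0],
    !![1, 0; 0, 0; 0, 0]]

lemma sum_leftCoeff_mul_rightCoeff_mul_outCoeff :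
    ∀ (a b c : Fin 3) (d : Fin 2) (i : Fin 3) (j : Fin 2),
      ∑ k, leftCoeff k a b * rightCoeff k c d * outCoeff k i j =
        if a = i ∧ b = c ∧ d = j then 1 else 0 := by
  decide +kernel

end HopcroftKerr

/-- Integer coefficients satisfying Brent's equations compute the matrix product over every
commutative ring. -/
lemma Matrix.mul_eq_sum_intCoeffForm_of_brent {l m n ι : Type*} [Fintype l] [Fintype m] [Fintype n]
    [Fintype ι] [DecidableEq l] [DecidableEq m] [DecidableEq n] (K : Type*) [CommRing K]
    (U : ι → Matrix l m ℤ) (V : ι → Matrix m n ℤ) (W : ι → Matrix l n ℤ)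
    (h : ∀ a b c d i j, ∑ k, U k a b * V k c d * W k i j = if a = i ∧ b = c ∧ d = j then 1 else 0)
    (A : Matrix l m K) (B : Matrix m n K) :
    A * B = ∑ k, (Matrix.intCoeffForm K (U k) A * Matrix.intCoeffForm K (V k) B) •
      (W k).map (Int.cast : ℤ → K) := by
  ext i j
  have h_cast (a b c d) : ∑ k, (U k a b : K) * V k c d * W k i j =
      if a = i ∧ b = c ∧ d = j then 1 else 0 := by
    exact_mod_cast congrArg (Int.cast : ℤ → K) (h a b c d i j)
  symm
  calc (∑ k, (Matrix.intCoeffForm K (U k) A * Matrix.intCoeffForm K (V k) B) •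
        (W k).map (Int.cast : ℤ → K)) i j
      = ∑ k, ∑ a, ∑ b, ∑ c, ∑ d,
          (U k a b : K) * V k c d * W k i j * (A a b * B c d) := by
        simp only [Matrix.sum_apply, Matrix.smul_apply, Matrix.map_apply, smul_eq_mul,
          Matrix.intCoeffForm_apply]
        refine Finset.sum_congr rfl fun k _ => ?_
        rw [mul_assoc]
        simp only [Finset.sum_mul]
        refine Finset.sum_congr rfl fun a _ => Finset.sum_congr rfl fun b _ => ?_
        simp only [Finset.mul_sum]
        exact Finset.sum_congr rfl fun c _ => Finset.sum_congr rfl fun d _ => by ring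
    _ = ∑ a, ∑ b, ∑ c, ∑ d,
          (∑ k, (U k a b : K) * V k c d * W k i j) * (A a b * B c d) := by
        simp only [Finset.sum_mul]
        rw [Finset.sum_comm]
        refine Finset.sum_congr rfl fun a _ => ?_
        rw [Finset.sum_comm]
        refine Finset.sum_congr rfl fun b _ => ?_
        rw [Finset.sum_comm]
        exact Finset.sum_congr rfl fun c _ => Finset.sum_comm
    _ = (A * B) i j := by
        simp [h_cast, Matrix.mul_apply, ite_and]

/-- Hopcroft–Kerr: for every commutative ring `K`, the 3×3 by 3×2 matrix multiplication
map over `K` admits a bilinear algorithm using 15 coefficient multiplications. -/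
theorem hopcroft_kerr_3x3x2_algorithm_with_15_mults (K : Type*) [CommRing K] :
    ∃ (φ : Fin 15 → (Matrix (Fin 3) (Fin 3) K →ₗ[K] K))
      (ψ : Fin 15 → (Matrix (Fin 3) (Fin 2) K →ₗ[K] K))
      (W : Fin 15 → Matrix (Fin 3) (Fin 2) K),
      ∀ (A : Matrix (Fin 3) (Fin 3) K) (B : Matrix (Fin 3) (Fin 2) K),
        A * B = ∑ k : Fin 15, (φ k A * ψ k B) • W k := by
  exact ⟨fun k => Matrix.intCoeffForm K (HopcroftKerr.leftCoeff k),
    fun k => Matrix.intCoeffForm K (HopcroftKerr.rightCoeff k),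
    fun k => (HopcroftKerr.outCoeff k).map (Int.cast : ℤ → K),
    Matrix.mul_eq_sum_intCoeffForm_of_brent K HopcroftKerr.leftCoeff
      HopcroftKerr.rightCoeff HopcroftKerr.outCoeff
      HopcroftKerr.sum_leftCoeff_mul_rightCoeff_mul_outCoeff⟩
end
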